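/- arXiv:1908.08349 — 10 statements merged into one kernel-verified Lean document; each statement's English description precedes it below -/
import Mathlib

section
/- Let X be a nonempty set, let Φ be a mapping with domain X², and let a₀ ∈ Φ(X²). Then Φ is a₀-coherent if and only if the fiber R = Φ⁻¹(a₀) is an equivalence relation on X and the equality Φ⁻¹(b) = R ∘ Φ⁻¹(b) ∘ R holds for every b ∈ Φ(X²). -/
namespace CombSimPaper

/-- The range `Φ(X²)` of a mapping `Φ` with domain `X²`. -/
def rng {X A : Type*} (Φ : X → X → A) : Set A := {a | ∃ x y, Φ x y = a}

/-- `Φ` is strongly consistent with the binary relation `R` on `X`. -/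
def StronglyConsistent {X A : Type*} (Φ : X → X → A) (R : X → X → Prop) : Prop :=
  ∀ x₁ x₂ x₃ x₄, R x₁ x₂ → R x₃ x₄ → Φ x₁ x₃ = Φ x₂ x₄

/-- The fiber `Φ⁻¹(a)`, viewed as a binary relation on `X`. -/
def fiber {X A : Type*} (Φ : X → X → A) (a : A) : X → X → Prop :=
  fun x y => Φ x y = a

/-- `Φ` is `a₀`-coherent: the fiber `Φ⁻¹(a₀)` is an equivalence relation and `Φ` is
strongly consistent with it. -/
def Coherent {X A : Type*} (Φ : X → X → A) (a₀ : A) : Prop :=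
  Equivalence (fiber Φ a₀) ∧ StronglyConsistent Φ (fiber Φ a₀)

/-- `g : Y → X` is a combinatorial similarity for the mappings `Ψ` (with domain `Y²`)
and `Φ` (with domain `X²`). -/
def CombSimWith {X Y A B : Type*} (Φ : X → X → A) (Ψ : Y → Y → B) (g : Y → X) : Prop :=
  Function.Bijective g ∧ ∃ f : A → B, Set.BijOn f (rng Φ) (rng Ψ) ∧
    ∀ x y : Y, Ψ x y = f (Φ (g x) (g y))

/-- `Φ` is combinatorially similar to `Ψ`. -/
def CombSim {X Y A B : Type*} (Φ : X → X → A) (Ψ : Y → Y → B) : Prop :=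
  ∃ g : Y → X, CombSimWith Φ Ψ g

/-- Some permutation `⟨x_{i₁}, x_{i₂}, x_{i₃}⟩` of the triple `⟨x₁, x₂, x₃⟩`
satisfies the ternary predicate `P`. -/
def PermTriple {X : Type*} (P : X → X → X → Prop) (x₁ x₂ x₃ : X) : Prop :=
  ∃ σ : Equiv.Perm (Fin 3),
    P (![x₁, x₂, x₃] (σ 0)) (![x₁, x₂, x₃] (σ 1)) (![x₁, x₂, x₃] (σ 2))

/-- `d : X² → Q` is a `≼`-pseudoultrametric (for the order `le` with smallest element `q₀`). -/
def QPseudoUltra {X Q : Type*} (le : Q → Q → Prop) (q₀ : Q) (d : X → X → Q) : Prop :=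
  (∀ x y, d x y = d y x) ∧ (∀ x, d x x = q₀) ∧
  ∀ x₁ x₂ x₃, PermTriple (fun a b c => le (d a c) (d a b) ∧ d a b = d b c) x₁ x₂ x₃

/-- `d : X² → Q` is a `≼`-ultrametric. -/
def QUltra {X Q : Type*} (le : Q → Q → Prop) (q₀ : Q) (d : X → X → Q) : Prop :=
  QPseudoUltra le q₀ d ∧ ∀ x y, d x y = q₀ ↔ x = y

/-- The binary relation `u_Φ` on the range of `Φ`. -/
def uRel {X A : Type*} (Φ : X → X → A) : A → A → Prop :=
  fun y₁ y₂ => ∃ x₁ x₂ x₃, y₁ = Φ x₁ x₃ ∧ y₂ = Φ x₁ x₂ ∧ Φ x₁ x₂ = Φ x₂ x₃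

/-- The binary relation `≼_Φ := u_Φᵗ ∪ Δ_{Φ(X²)}`. -/
def lePhi {X A : Type*} (Φ : X → X → A) : A → A → Prop :=
  fun a b => Relation.TransGen (uRel Φ) a b ∨ (a = b ∧ a ∈ rng Φ)

/-- `r` is a partial order on the subset `S`. -/
def IsPartialOrderOn {A : Type*} (S : Set A) (r : A → A → Prop) : Prop :=
  (∀ a ∈ S, r a a) ∧
  (∀ a b c, a ∈ S → b ∈ S → c ∈ S → r a b → r b c → r a c) ∧
  (∀ a b, a ∈ S → b ∈ S → r a b → r b a → a = b)

/-- `r` is a linear (total) order on the subset `S`. -/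
def IsLinearOrderOn {A : Type*} (S : Set A) (r : A → A → Prop) : Prop :=
  IsPartialOrderOn S r ∧ ∀ a b, a ∈ S → b ∈ S → (r a b ∨ r b a)

/-- A (real-valued, nonnegative) pseudometric. -/
def IsPseudoMetric {X : Type*} (d : X → X → ℝ) : Prop :=
  (∀ x y, 0 ≤ d x y) ∧ (∀ x y, d x y = d y x) ∧ (∀ x, d x x = 0) ∧
  ∀ x y z, d x y ≤ d x z + d z y

/-- A (real-valued) metric. -/
def IsMetric {X : Type*} (d : X → X → ℝ) : Prop :=
  IsPseudoMetric d ∧ ∀ x y, d x y = 0 ↔ x = y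

/-- A (real-valued, nonnegative) pseudoultrametric. -/
def IsPseudoUltrametric {X : Type*} (d : X → X → ℝ) : Prop :=
  (∀ x y, 0 ≤ d x y) ∧ (∀ x y, d x y = d y x) ∧ (∀ x, d x x = 0) ∧
  ∀ x y z, d x y ≤ max (d x z) (d z y)

/-- A (real-valued) ultrametric. -/
def IsUltrametric {X : Type*} (d : X → X → ℝ) : Prop :=
  IsPseudoUltrametric d ∧ ∀ x y, d x y = 0 ↔ x = y

/-- `d` is a `le`-pseudoultrametric, where `le` is a partial order on `Q` having a smallest
element. -/
def IsPseudoUltraFor {X Q : Type*} (d : X → X → Q) (le : Q → Q → Prop) : Prop :=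
  IsPartialOrder Q le ∧ ∃ q₀, (∀ q, le q₀ q) ∧ QPseudoUltra le q₀ d

/-- `g : X₁ → X₂` is a weak similarity for the `Q₁`-pseudoultrametric `d₁` and the
`Q₂`-pseudoultrametric `d₂`: `g` is a bijection and there is an order isomorphism
`f` of the subposet `d₂(X₂²)` of `Q₂` onto the subposet `d₁(X₁²)` of `Q₁` with
`d₁(x, y) = f (d₂ (g x) (g y))`. -/
def WeakSim {X₁ X₂ Q₁ Q₂ : Type*} (le₁ : Q₁ → Q₁ → Prop) (le₂ : Q₂ → Q₂ → Prop)
    (d₁ : X₁ → X₁ → Q₁) (d₂ : X₂ → X₂ → Q₂) (g : X₁ → X₂) : Prop :=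
  Function.Bijective g ∧ ∃ f : Q₂ → Q₁,
    Set.BijOn f (rng d₂) (rng d₁) ∧
    (∀ a ∈ rng d₂, ∀ b ∈ rng d₂, (le₂ a b ↔ le₁ (f a) (f b))) ∧
    ∀ x y, d₁ x y = f (d₂ (g x) (g y))

/-- The subset `S`, ordered by `r`, is order-isomorphic to a subposet of `(ℝ⁺, ≤)`. -/
def EmbedsInRPlus {A : Type*} (S : Set A) (r : A → A → Prop) : Prop :=
  ∃ e : A → ℝ, (∀ a ∈ S, 0 ≤ e a) ∧ Set.InjOn e S ∧
    ∀ a ∈ S, ∀ b ∈ S, (r a b ↔ e a ≤ e b)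

/-- Proposition 2.7: `Φ` is `a₀`-coherent iff the fiber `R = Φ⁻¹(a₀)` is an equivalence
relation and `Φ⁻¹(b) = R ∘ Φ⁻¹(b) ∘ R` for every `b` in the range of `Φ`. -/
theorem statement1 {X A : Type*} [Nonempty X] (Φ : X → X → A) (a₀ : A) (ha : a₀ ∈ rng Φ) :
    Coherent Φ a₀ ↔
      Equivalence (fiber Φ a₀) ∧
        ∀ b ∈ rng Φ,
          fiber Φ b =
            Relation.Comp (Relation.Comp (fiber Φ a₀) (fiber Φ b)) (fiber Φ a₀) := by
  constructor
  · rintro ⟨hE, hS⟩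
    refine ⟨hE, fun b _ => ?_⟩
    funext x y
    refine propext ⟨fun h => ⟨y, ⟨x, hE.refl x, h⟩, hE.refl y⟩, ?_⟩
    rintro ⟨v, ⟨u, hxu, huv⟩, hvy⟩
    exact (hS x u y v hxu (hE.symm hvy)).trans huv
  · rintro ⟨hE, hC⟩
    refine ⟨hE, fun x₁ x₂ x₃ x₄ h₁₂ h₃₄ => ?_⟩
    have h : fiber Φ (Φ x₂ x₄) x₁ x₃ := by
      rw [hC _ ⟨x₂, x₄, rfl⟩]
      exact ⟨x₄, ⟨x₂, h₁₂, rfl⟩, hE.symm h₃₄⟩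
    exact h

end CombSimPaper
end

section
/- Let X be a nonempty set, let Φ be a mapping with domain X², and let a₀ ∈ Φ(X²). Then Φ is a₀-coherent if and only if the fiber R = Φ⁻¹(a₀) is an equivalence relation on X and the partition P_R ⊗ P_R¹ of X² is a refinement of the partition {Φ⁻¹(b) : b ∈ Φ(X²)} of X², where P_R is the partition of X whose blocks are the equivalence classes of R. -/
namespace CombSimPaper

/-- Theorem 2.10: `Φ` is `a₀`-coherent iff the fiber `R = Φ⁻¹(a₀)` is an equivalence
relation and every block of the partition `P_R ⊗ P_R¹` of `X²` (namely the union block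
`⋃_j X_j² = R` and the products `X_{j₁} × X_{j₂}` of distinct equivalence classes)
is contained in some fiber `Φ⁻¹(b)`, `b ∈ Φ(X²)`. -/
theorem statement2 {X A : Type*} [Nonempty X] (Φ : X → X → A) (a₀ : A) (ha : a₀ ∈ rng Φ) :
    Coherent Φ a₀ ↔
      Equivalence (fiber Φ a₀) ∧
        ∀ B : Set (X × X),
          (B = {p : X × X | fiber Φ a₀ p.1 p.2} ∨
            ∃ x y : X, ¬ fiber Φ a₀ x y ∧
              B = {p : X × X | fiber Φ a₀ p.1 x ∧ fiber Φ a₀ p.2 y}) →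
          ∃ b ∈ rng Φ, B ⊆ {p : X × X | Φ p.1 p.2 = b} := by
  refine and_congr_right fun hR => ⟨?_, ?_⟩
  · rintro hΦ B (rfl | ⟨x, y, -, rfl⟩)
    · exact ⟨a₀, ha, fun p hp => hp⟩
    · exact ⟨Φ x y, ⟨x, y, rfl⟩, fun p hp => hΦ p.1 x p.2 y hp.1 hp.2⟩
  · intro h x₁ x₂ x₃ x₄ h₁₂ h₃₄
    by_cases h₁₃ : fiber Φ a₀ x₁ x₃
    · have h₂₄ : fiber Φ a₀ x₂ x₄ := hR.trans (hR.symm h₁₂) (hR.trans h₁₃ h₃₄)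
      exact h₁₃.trans h₂₄.symm
    · obtain ⟨b, -, hb⟩ := h _ (Or.inr ⟨x₁, x₃, h₁₃, rfl⟩)
      have hb₁₃ : Φ x₁ x₃ = b := @hb (x₁, x₃) ⟨hR.refl x₁, hR.refl x₃⟩
      have hb₂₄ : Φ x₂ x₄ = b := @hb (x₂, x₄) ⟨hR.symm h₁₂, hR.symm h₃₄⟩
      exact hb₁₃.trans hb₂₄.symm

end CombSimPaper
end

section
/- Let X be a nonempty set, let (Q,≼_Q) be a partially ordered set with smallest element q₀, and let d : X² → Q be a ≼_Q-pseudoultrametric on X. Then the fiber d⁻¹(q₀) = {⟨x,y⟩ ∈ X² : d(x,y) = q₀} is an equivalence relation on X and the mapping d is q₀-coherent. -/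
namespace CombSimPaper

/-- In a pseudoultrametric, points at the smallest distance from each other are equidistant
from every third point. -/
theorem QPseudoUltra.dist_eq_of_dist_eq_bot {X Q : Type*} {leQ : Q → Q → Prop} {q₀ : Q}
    {d : X → X → Q} (hd : QPseudoUltra leQ q₀ d) (hbot : ∀ q, leQ q q₀ → q = q₀)
    {x y : X} (z : X) (h : d x y = q₀) : d x z = d y z := by
  obtain ⟨hsymm, -, htri⟩ := hd
  obtain ⟨σ, hle, heq⟩ := htri x y z
  have hyx : d y x = q₀ := hsymm y x ▸ h
  have hzx := hsymm z x
  have hzy := hsymm z y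
  have h01 : σ 0 ≠ σ 1 := σ.injective.ne (by decide)
  have h02 : σ 0 ≠ σ 2 := σ.injective.ne (by decide)
  have h12 : σ 1 ≠ σ 2 := σ.injective.ne (by decide)
  generalize σ 0 = i at *
  generalize σ 1 = j at *
  generalize σ 2 = k at *
  fin_cases i <;> fin_cases j <;> fin_cases k <;> simp at h01 h02 h12 hle heq <;> grind

/-- Proposition 3.12: for a `≼_Q`-pseudoultrametric `d` (with smallest element `q₀`),
the fiber `d⁻¹(q₀)` is an equivalence relation and `d` is `q₀`-coherent. -/
theorem statement3 {X Q : Type*} [Nonempty X]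
    (leQ : Q → Q → Prop) (q₀ : Q) (hpo : IsPartialOrder Q leQ) (hq₀ : ∀ q, leQ q₀ q)
    (d : X → X → Q) (hd : QPseudoUltra leQ q₀ d) :
    Equivalence (fiber d q₀) ∧ Coherent d q₀ := by
  have hbot : ∀ q, leQ q q₀ → q = q₀ := fun q hq => hpo.antisymm q q₀ hq (hq₀ q)
  have key := fun {x y : X} (z : X) (h : d x y = q₀) => hd.dist_eq_of_dist_eq_bot hbot z h
  have hsymm := hd.1
  have hequiv : Equivalence (fiber d q₀) :=
    ⟨hd.2.1, fun {x y} h => (hsymm y x).trans h, fun {_ _ z} hxy hyz => (key z hxy).trans hyz⟩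
  refine ⟨hequiv, hequiv, fun x₁ x₂ x₃ x₄ h₁₂ h₃₄ => ?_⟩
  rw [key x₃ h₁₂, hsymm x₂ x₃, key x₂ h₃₄, hsymm x₄ x₂]

end CombSimPaper
end

section
/- Let X be a nonempty set and let Φ be a mapping with domain X² such that |Φ(X²)| ≤ ℵ₀. Then the following three conditions are equivalent: (i) Φ is combinatorially similar to a pseudoultrametric d : X² → ℝ⁺ whose range is contained in the nonnegative rationals ℚ⁺; (ii) Φ is combinatorially similar to a pseudoultrametric; (iii) Φ is symmetric, the transitive closure u_Φᵗ of the binary relation u_Φ is antisymmetric, Φ is a₀-coherent for some a₀ ∈ Φ(X²), and for every triple ⟨x₁,x₂,x₃⟩ of points of X there is a permutation ⟨x_{i₁},x_{i₂},x_{i₃}⟩ of it such that Φ(x_{i₁},x_{i₂}) = Φ(x_{i₂},x_{i₃}). -/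
namespace CombSimPaper

universe u v

/-- For symmetric `Φ`, a triple has an isosceles permutation iff two of its three values agree. -/
lemma permTriple_isosceles_iff {X A : Type*} {Φ : X → X → A} (hsymm : ∀ x y, Φ x y = Φ y x)
    (x y z : X) :
    PermTriple (fun a b c => Φ a b = Φ b c) x y z ↔
      Φ x y = Φ y z ∨ Φ x y = Φ x z ∨ Φ x z = Φ y z := by
  constructor
  · rintro ⟨σ, hσ⟩
    have h01 : σ 0 ≠ σ 1 := by simp
    have h02 : σ 0 ≠ σ 2 := by simp
    have h12 : σ 1 ≠ σ 2 := by simp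
    generalize σ 0 = i at *
    generalize σ 1 = j at *
    generalize σ 2 = k at *
    fin_cases i <;> fin_cases j <;> fin_cases k <;> simp at * <;> grind
  · rintro (h | h | h)
    · exact ⟨1, by simpa using h⟩
    · refine ⟨Equiv.swap 0 1, ?_⟩
      have h2 : Equiv.swap (0 : Fin 3) 1 2 = 2 := by decide
      simpa [h2, hsymm y x] using h
    · refine ⟨Equiv.swap 1 2, ?_⟩
      have h0 : Equiv.swap (1 : Fin 3) 2 0 = 0 := by decide
      simpa [h0, hsymm z y] using h

lemma IsPseudoUltrametric.isosceles {X : Type*} {d : X → X → ℝ} (hd : IsPseudoUltrametric d)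
    (x y z : X) : d x y = d y z ∨ d x y = d x z ∨ d x z = d y z := by
  obtain ⟨-, hsymm, -, htri⟩ := hd
  have h₁ := htri x y z
  have h₂ := htri y z x
  have h₃ := htri x z y
  rw [hsymm z y] at h₁
  rw [hsymm y x] at h₂
  rw [le_max_iff] at h₁ h₂ h₃
  rcases lt_trichotomy (d x y) (d y z) with h | h | h
  · exact .inr (.inr (by rcases h₂ with h₂ | h₂ <;> rcases h₃ with h₃ | h₃ <;> linarith))
  · exact .inl h
  · exact .inr (.inl (by rcases h₁ with h₁ | h₁ <;> rcases h₃ with h₃ | h₃ <;> linarith))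

lemma IsPseudoUltrametric.comp {X Y : Type*} {d : Y → Y → ℝ} (hd : IsPseudoUltrametric d)
    (h : X → Y) : IsPseudoUltrametric fun x y => d (h x) (h y) :=
  ⟨fun _ _ => hd.1 _ _, fun _ _ => hd.2.1 _ _, fun _ => hd.2.2.1 _, fun _ _ _ => hd.2.2.2 _ _ _⟩

/-- A combinatorial similarity to a pseudoultrametric on `Y` can be transported to `X`. -/
lemma CombSim.exists_injOn {X Y A : Type*} {Φ : X → X → A} {d : Y → Y → ℝ}
    (hd : IsPseudoUltrametric d) (h : CombSim Φ d) :
    ∃ f : A → ℝ, Set.InjOn f (rng Φ) ∧ IsPseudoUltrametric fun x y => f (Φ x y) := by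
  obtain ⟨g, hg, f, hf, hfd⟩ := h
  refine ⟨f, hf.injOn, ?_⟩
  convert hd.comp (Function.surjInv hg.surjective) using 3 with x y
  rw [hfd, Function.surjInv_eq hg.surjective, Function.surjInv_eq hg.surjective]

lemma uRel.mem_rng {X A : Type*} {Φ : X → X → A} {a b : A} (h : uRel Φ a b) :
    a ∈ rng Φ ∧ b ∈ rng Φ := by
  obtain ⟨x, y, z, rfl, rfl, -⟩ := h
  exact ⟨⟨x, z, rfl⟩, x, y, rfl⟩

lemma mem_rng_of_transGen_uRel {X A : Type*} {Φ : X → X → A} {a b : A}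
    (h : Relation.TransGen (uRel Φ) a b) : a ∈ rng Φ ∧ b ∈ rng Φ := by
  induction h with
  | single h => exact h.mem_rng
  | tail _ h ih => exact ⟨ih.1, h.mem_rng.2⟩

lemma le_of_transGen_uRel {X A : Type*} {Φ : X → X → A} {f : A → ℝ}
    (hf : IsPseudoUltrametric fun x y => f (Φ x y)) {a b : A}
    (h : Relation.TransGen (uRel Φ) a b) : f a ≤ f b := by
  have step {a b : A} (h : uRel Φ a b) : f a ≤ f b := by
    obtain ⟨x, y, z, rfl, rfl, h⟩ := h
    simpa [← h] using hf.2.2.2 x z y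
  induction h with
  | single h => exact step h
  | tail _ h ih => exact ih.trans (step h)

lemma coherent_of_isPseudoUltrametric {X A : Type*} {Φ : X → X → A} {f : A → ℝ}
    (hinj : Set.InjOn f (rng Φ)) (hf : IsPseudoUltrametric fun x y => f (Φ x y)) (p : X) :
    Coherent Φ (Φ p p) := by
  have inj {x y z w : X} (h : f (Φ x y) = f (Φ z w)) : Φ x y = Φ z w :=
    hinj ⟨_, _, rfl⟩ ⟨_, _, rfl⟩ h
  obtain ⟨hnn, hsymm, hzero, htri⟩ := hf
  have key {x y : X} : fiber Φ (Φ p p) x y ↔ f (Φ x y) = 0 :=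
    ⟨fun h => (congrArg f h).trans (hzero p), fun h => inj (h.trans (hzero p).symm)⟩
  refine ⟨⟨fun x => key.2 (hzero x), fun {x y} h => key.2 ((hsymm y x).trans (key.1 h)),
    fun {x y z} hxy hyz => key.2 (le_antisymm ?_ (hnn x z))⟩, fun x₁ x₂ x₃ x₄ h h' => inj ?_⟩
  · have := htri x z y
    simpa [key.1 hxy, key.1 hyz] using this
  · have le {u v w t : X} (h : f (Φ u v) = 0) (h' : f (Φ w t) = 0) :
        f (Φ u w) ≤ f (Φ v t) := by
      have h₁ := htri u w v
      have h₂ := htri v w t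
      have h₃ := hsymm w t
      have h₄ := hnn v w
      have h₅ := hnn v t
      grind
    have h₁ := le (key.1 h) (key.1 h')
    have h₂ := le ((hsymm _ _).trans (key.1 h)) ((hsymm _ _).trans (key.1 h'))
    exact le_antisymm h₁ h₂

/-- A relation on a countable set whose transitive closure is antisymmetric can be
monotonically and injectively mapped into the rationals. -/
lemma exists_rat_injOn_of_antisymm {A : Type*} {S : Set A} (hS : S.Countable)
    {r : A → A → Prop} (hr : ∀ a b, Relation.TransGen r a b → Relation.TransGen r b a → a = b) :
    ∃ e : A → ℚ, Set.InjOn e S ∧ ∀ a ∈ S, ∀ b ∈ S, r a b → e a ≤ e b := by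
  classical
  let _ : PartialOrder S :=
    { le a b := Relation.ReflTransGen r a b
      le_refl _ := .refl
      le_trans _ _ _ := .trans
      le_antisymm a b hab hba := by
        rcases Relation.reflTransGen_iff_eq_or_transGen.1 hab with h | hab
        · exact Subtype.ext h.symm
        rcases Relation.reflTransGen_iff_eq_or_transGen.1 hba with h | hba
        · exact Subtype.ext h
        exact Subtype.ext (hr _ _ hab hba) }
  have : Countable (LinearExtension S) := hS.to_subtype
  obtain ⟨φ⟩ := Order.embedding_from_countable_to_dense (LinearExtension S) ℚ
  have hval {a : A} (ha : a ∈ S) : (if h : a ∈ S then φ (toLinearExtension ⟨a, h⟩) else 0) =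
      φ (toLinearExtension ⟨a, ha⟩) := dif_pos ha
  refine ⟨fun a => if h : a ∈ S then φ (toLinearExtension ⟨a, h⟩) else 0, ?_, ?_⟩
  · intro a ha b hb hab
    simp only [hval ha, hval hb] at hab
    exact congrArg Subtype.val (φ.injective hab)
  · intro a ha b hb hab
    simp only [hval ha, hval hb]
    exact φ.monotone (toLinearExtension.monotone (Relation.ReflTransGen.single hab))

/-- An injective relabelling of the values of `Φ` gives a combinatorially similar mapping. -/
lemma combSim_of_injOn {X A B : Type*} {Φ : X → X → A} {f : A → B}
    (hf : Set.InjOn f (rng Φ)) : CombSim Φ fun x y => f (Φ x y) := by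
  refine ⟨id, Function.bijective_id, f, ⟨?_, hf, ?_⟩, fun _ _ => rfl⟩
  · rintro _ ⟨x, y, rfl⟩
    exact ⟨x, y, rfl⟩
  · rintro _ ⟨x, y, rfl⟩
    exact ⟨_, ⟨x, y, rfl⟩, rfl⟩

/-- A mapping that is constant on the diagonal and has isosceles triples becomes a
pseudoultrametric once its values are relabelled monotonically with respect to `uRel`. -/
lemma isPseudoUltrametric_of_uRel_monotone {X A : Type*} {Φ : X → X → A} {f : A → ℝ} {a₀ : A}
    (hsymm : ∀ x y, Φ x y = Φ y x) (hdiag : ∀ x, Φ x x = a₀) (hf₀ : f a₀ = 0)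
    (hmono : ∀ a b, uRel Φ a b → f a ≤ f b)
    (hiso : ∀ x y z, PermTriple (fun a b c => Φ a b = Φ b c) x y z) :
    IsPseudoUltrametric fun x y => f (Φ x y) := by
  refine ⟨fun x y => ?_, fun x y => congrArg f (hsymm x y), fun x => ?_, fun x y z => ?_⟩
  · rw [← hf₀]
    exact hmono _ _ ⟨x, y, x, (hdiag x).symm, rfl, hsymm x y⟩
  · simp [hdiag, hf₀]
  · rcases (permTriple_isosceles_iff hsymm x z y).1 (hiso x z y) with h | h | h
    · exact (hmono _ _ ⟨x, z, y, rfl, rfl, h⟩).trans (le_max_left _ _)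
    · exact (congrArg f h).ge.trans (le_max_left _ _)
    · exact (congrArg f h).le.trans (le_max_right _ _)

/-- Theorem 3.7: for a mapping `Φ` with domain `X²` and at most countable range, the
following are equivalent: (i) `Φ` is combinatorially similar to a pseudoultrametric on `X`
with range in `ℚ⁺`; (ii) `Φ` is combinatorially similar to a pseudoultrametric;
(iii) `Φ` is symmetric, `u_Φᵗ` is antisymmetric, `Φ` is `a₀`-coherent for some `a₀` in its
range, and every triple of points admits an "isosceles" permutation. -/
theorem statement4 {X : Type u} {A : Type v} [Nonempty X]
    (Φ : X → X → A) (hcount : (rng Φ).Countable) :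
    List.TFAE [
      ∃ d : X → X → ℝ, IsPseudoUltrametric d ∧ (∀ x y, ∃ q : ℚ, 0 ≤ q ∧ d x y = (q : ℝ)) ∧
        CombSim Φ d,
      ∃ (Y : Type u) (_ : Nonempty Y) (d : Y → Y → ℝ), IsPseudoUltrametric d ∧ CombSim Φ d,
      (∀ x y, Φ x y = Φ y x) ∧
        AntiSymmetric (Relation.TransGen (uRel Φ)) ∧
        (∃ a₀ ∈ rng Φ, Coherent Φ a₀) ∧
        ∀ x₁ x₂ x₃ : X, PermTriple (fun a b c => Φ a b = Φ b c) x₁ x₂ x₃ ] := by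
  tfae_have 1 → 2 := fun ⟨d, hd, _, h⟩ => ⟨X, inferInstance, d, hd, h⟩
  tfae_have 2 → 3 := by
    rintro ⟨Y, -, d, hd, h⟩
    obtain ⟨f, hinj, hf⟩ := h.exists_injOn hd
    have inj {x y z w : X} (h : f (Φ x y) = f (Φ z w)) : Φ x y = Φ z w :=
      hinj ⟨_, _, rfl⟩ ⟨_, _, rfl⟩ h
    have hsymm (x y : X) : Φ x y = Φ y x := inj (hf.2.1 x y)
    obtain ⟨p⟩ := ‹Nonempty X›
    refine ⟨hsymm, fun a b hab hba => ?_, ⟨Φ p p, ⟨p, p, rfl⟩,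
      coherent_of_isPseudoUltrametric hinj hf p⟩, fun x y z => ?_⟩
    · exact hinj (mem_rng_of_transGen_uRel hab).1 (mem_rng_of_transGen_uRel hab).2
        (le_antisymm (le_of_transGen_uRel hf hab) (le_of_transGen_uRel hf hba))
    · exact (permTriple_isosceles_iff hsymm x y z).2
        ((hf.isosceles x y z).imp inj (Or.imp inj inj))
  tfae_have 3 → 1 := by
    rintro ⟨hsymm, hanti, ⟨a₀, -, hcoh⟩, hiso⟩
    obtain ⟨e, hinj, hmono⟩ := exists_rat_injOn_of_antisymm hcount hanti
    let f : A → ℝ := fun a => ((e a - e a₀ : ℚ) : ℝ)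
    have hf : IsPseudoUltrametric fun x y => f (Φ x y) := by
      refine isPseudoUltrametric_of_uRel_monotone hsymm hcoh.1.refl (by simp [f])
        (fun a b hab => ?_) hiso
      exact Rat.cast_le.2 (sub_le_sub_right (hmono a hab.mem_rng.1 b hab.mem_rng.2 hab) _)
    refine ⟨_, hf, fun x y => ⟨e (Φ x y) - e a₀, Rat.cast_nonneg.1 (hf.1 x y), rfl⟩,
      combSim_of_injOn fun a ha b hb hab => hinj ha hb ?_⟩
    exact sub_left_injective (Rat.cast_injective hab)
  tfae_finish

end CombSimPaper
end

section
/- Let X be a nonempty set, let (Q,≼_Q) be a poset with smallest element, and let d : X² → Q be a ≼_Q-pseudoultrametric. Then there is a unique partial order ≼_Q⁰ on Q such that d is a ≼_Q⁰-pseudoultrametric and the inclusion ≼_Q⁰ ⊆ ≼ holds whenever ≼ is a partial order on Q for which d is a ≼-pseudoultrametric. -/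
namespace CombSimPaper

/-- If two sides of a triangle are equal, then the third one is at most their common value. -/
theorem QPseudoUltra.le_of_eq {X Q : Type*} {le : Q → Q → Prop} {q₀ : Q} {d : X → X → Q}
    (hd : QPseudoUltra le q₀ d) (hrefl : ∀ q, le q q) {x y z : X} (h : d x y = d y z) :
    le (d x z) (d x y) := by
  obtain ⟨hsymm, -, htri⟩ := hd
  obtain ⟨σ, hle, heq⟩ := htri x y z
  have h01 : σ 0 ≠ σ 1 := σ.injective.ne (by decide)
  have h02 : σ 0 ≠ σ 2 := σ.injective.ne (by decide)
  have h12 : σ 1 ≠ σ 2 := σ.injective.ne (by decide)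
  have hyx := hsymm y x
  have hzx := hsymm z x
  have hzy := hsymm z y
  generalize σ 0 = i at *
  generalize σ 1 = j at *
  generalize σ 2 = k at *
  fin_cases i <;> fin_cases j <;> fin_cases k <;> simp_all

/-- The intersection of all partial orders for which `d` is a pseudoultrametric. -/
def leInf {X Q : Type*} (d : X → X → Q) : Q → Q → Prop :=
  fun a b => ∀ le : Q → Q → Prop, IsPseudoUltraFor d le → le a b

theorem isPseudoUltraFor_leInf {X Q : Type*} [Nonempty X] {d : X → X → Q}
    {leQ : Q → Q → Prop} (h : IsPseudoUltraFor d leQ) : IsPseudoUltraFor d (leInf d) := by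
  obtain ⟨hpo, q₀, hq₀, hd⟩ := id h
  refine ⟨{ refl := fun a le hle => hle.1.refl a
            trans := fun a b c hab hbc le hle => hle.1.trans a b c (hab le hle) (hbc le hle)
            antisymm := fun a b hab hba => hpo.antisymm a b (hab leQ h) (hba leQ h) },
    q₀, fun q le hle => ?_, hd.1, hd.2.1, fun x₁ x₂ x₃ => ?_⟩
  · obtain ⟨-, q₁, hq₁, hd₁⟩ := hle
    obtain ⟨x⟩ := ‹Nonempty X›
    rw [← hd.2.1 x, hd₁.2.1 x]
    exact hq₁ q
  · obtain ⟨σ, -, heq⟩ := hd.2.2 x₁ x₂ x₃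
    refine ⟨σ, fun le hle => ?_, heq⟩
    obtain ⟨hpo₁, q₁, -, hd₁⟩ := hle
    exact hd₁.le_of_eq hpo₁.refl heq

/-- Proposition 3.17: for every `≼_Q`-pseudoultrametric `d` there is a unique weakest
partial order `≼_Q⁰` on `Q` for which `d` is still a pseudoultrametric. -/
theorem statement9 {X Q : Type*} [Nonempty X]
    (leQ : Q → Q → Prop) (q₀ : Q) (hpo : IsPartialOrder Q leQ) (hq₀ : ∀ q, leQ q₀ q)
    (d : X → X → Q) (hd : QPseudoUltra leQ q₀ d) :
    ∃! le₀ : Q → Q → Prop,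
      IsPseudoUltraFor d le₀ ∧
        ∀ le' : Q → Q → Prop, IsPseudoUltraFor d le' → ∀ a b, le₀ a b → le' a b := by
  have h : IsPseudoUltraFor d leQ := ⟨hpo, q₀, hq₀, hd⟩
  refine ⟨leInf d, ⟨isPseudoUltraFor_leInf h, fun le' h' a b hab => hab le' h'⟩, ?_⟩
  rintro le₁ ⟨h₁, hmin⟩
  funext a b
  exact propext ⟨fun hab le' h' => hmin le' h' a b hab, fun hab => hab le₁ h₁⟩

end CombSimPaper
end

section
/- Let X be a nonempty set, let (Q,≼_Q) be a poset with smallest element, and let d : X² → Q be a ≼_Q-pseudoultrametric with d(X²) = Q. Then ≼_Q⁰ = u_dᵗ ∪ Δ_Q, where ≼_Q⁰ is the weakest partial order on Q for which d is a pseudoultrametric, and Δ_Q = {⟨q,q⟩ : q ∈ Q}. -/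
namespace CombSimPaper

theorem PermTriple.mono {X : Type*} {P P' : X → X → X → Prop} (h : ∀ a b c, P a b c → P' a b c)
    {x₁ x₂ x₃ : X} (hP : PermTriple P x₁ x₂ x₃) : PermTriple P' x₁ x₂ x₃ :=
  hP.imp fun _ hσ => h _ _ _ hσ

theorem PermTriple.cases {X : Type*} {P : X → X → X → Prop} {x₁ x₂ x₃ : X}
    (h : PermTriple P x₁ x₂ x₃) :
    P x₁ x₂ x₃ ∨ P x₁ x₃ x₂ ∨ P x₂ x₁ x₃ ∨ P x₂ x₃ x₁ ∨ P x₃ x₁ x₂ ∨ P x₃ x₂ x₁ := by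
  obtain ⟨σ, hσ⟩ := h
  have h₀₁ : σ 0 ≠ σ 1 := σ.injective.ne (by decide)
  have h₀₂ : σ 0 ≠ σ 2 := σ.injective.ne (by decide)
  have h₁₂ : σ 1 ≠ σ 2 := σ.injective.ne (by decide)
  generalize σ 0 = i at *
  generalize σ 1 = j at *
  generalize σ 2 = k at *
  fin_cases i <;> fin_cases j <;> fin_cases k <;> simp_all

/-- The base of an isosceles triangle does not exceed its legs. -/
theorem QPseudoUltra.le_of_uRel {X Q : Type*} {le : Q → Q → Prop} [Std.Refl le] {q₀ : Q}
    {d : X → X → Q} (hd : QPseudoUltra le q₀ d) {a b : Q} (h : uRel d a b) : le a b := by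
  obtain ⟨x₁, x₂, x₃, rfl, rfl, h⟩ := h
  obtain ⟨hsymm, -, htri⟩ := hd
  have hrefl := refl_of le (d x₁ x₂)
  have h₁₂ := hsymm x₁ x₂
  have h₁₃ := hsymm x₁ x₃
  have h₂₃ := hsymm x₂ x₃
  rcases (htri x₁ x₂ x₃).cases with h | h | h | h | h | h <;> grind

theorem QPseudoUltra.le_of_transGen_uRel_or_eq {X Q : Type*} {le : Q → Q → Prop}
    [IsPreorder Q le] {q₀ : Q} {d : X → X → Q} (hd : QPseudoUltra le q₀ d) {a b : Q}
    (h : Relation.TransGen (uRel d) a b ∨ a = b) : le a b := by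
  rcases h with h | rfl
  · induction h with
    | single h => exact hd.le_of_uRel h
    | tail _ h ih => exact trans_of le ih (hd.le_of_uRel h)
  · exact refl_of le a

/-- Lemma 3.18: if `d` is a `≼_Q`-pseudoultrametric with `d(X²) = Q`, then the weakest
partial order on `Q` for which `d` is a pseudoultrametric is exactly `u_dᵗ ∪ Δ_Q`. -/
theorem statement10 {X Q : Type*} [Nonempty X]
    (leQ : Q → Q → Prop) (q₀ : Q) (hpo : IsPartialOrder Q leQ) (hq₀ : ∀ q, leQ q₀ q)
    (d : X → X → Q) (hd : QPseudoUltra leQ q₀ d) (hrng : rng d = Set.univ) :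
    IsPseudoUltraFor d (fun a b => Relation.TransGen (uRel d) a b ∨ a = b) ∧
      ∀ le' : Q → Q → Prop, IsPseudoUltraFor d le' →
        ∀ a b, (Relation.TransGen (uRel d) a b ∨ a = b) → le' a b := by
  refine ⟨⟨?_, q₀, fun q => ?_, hd.1, hd.2.1, fun x₁ x₂ x₃ => ?_⟩,
    fun le' ⟨_, _, _, hd'⟩ a b h => hd'.le_of_transGen_uRel_or_eq h⟩
  · exact
      { refl := fun _ => .inr rfl
        trans := by
          rintro a b c (hab | rfl) (hbc | rfl)
          exacts [.inl (hab.trans hbc), .inl hab, .inl hbc, .inr rfl]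
        antisymm := fun a b hab hba =>
          antisymm_of leQ (hd.le_of_transGen_uRel_or_eq hab) (hd.le_of_transGen_uRel_or_eq hba) }
  · obtain ⟨x, y, rfl⟩ : q ∈ rng d := hrng ▸ Set.mem_univ q
    exact .inl (.single ⟨x, y, x, (hd.2.1 x).symm, rfl, hd.1 x y⟩)
  · exact (hd.2.2 x₁ x₂ x₃).mono fun a b c h => ⟨.inl (.single ⟨a, b, c, rfl, rfl, h.2⟩), h.2⟩

end CombSimPaper
end

section
/- Let (Q,≼_Q) and (L,≼_L) be posets with smallest elements q₀ ∈ Q and l₀ ∈ L. The following three conditions are equivalent for every mapping f : Q → L: (i) f ∘ d is an L-pseudoultrametric whenever d is a Q-pseudoultrametric (on any nonempty set X); (ii) f ∘ d is an L-pseudoultrametric whenever d is a Q-ultrametric; (iii) f is isotone and f(q₀) = l₀ holds. -/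
namespace CombSimPaper

universe u v w

/-- For a symmetric mapping, the triple condition says that one of the three distances is bounded
by the common value of the other two. -/
theorem permTriple_iff_of_symm {X Q : Type*} {le : Q → Q → Prop} {d : X → X → Q}
    (hd : ∀ x y, d x y = d y x) (x y z : X) :
    PermTriple (fun a b c => le (d a c) (d a b) ∧ d a b = d b c) x y z ↔
      (le (d x z) (d x y) ∧ d x y = d y z) ∨ (le (d x y) (d x z) ∧ d x z = d y z) ∨
        (le (d y z) (d x y) ∧ d x y = d x z) := by
  constructor
  · rintro ⟨σ, h⟩
    have h01 : σ 0 ≠ σ 1 := σ.injective.ne (by decide)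
    have h02 : σ 0 ≠ σ 2 := σ.injective.ne (by decide)
    have h12 : σ 1 ≠ σ 2 := σ.injective.ne (by decide)
    have hyx := hd y x
    have hzx := hd z x
    have hzy := hd z y
    generalize σ 0 = i at *
    generalize σ 1 = j at *
    generalize σ 2 = k at *
    fin_cases i <;> fin_cases j <;> fin_cases k <;> simp at h01 h02 h12 h <;> grind
  · rintro (h | h | h)
    · exact ⟨1, by simpa using h⟩
    · refine ⟨Equiv.swap 1 2, ?_⟩
      have h₁ : Equiv.swap (1 : Fin 3) 2 0 = 0 := by decide
      simpa [h₁, hd z y] using h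
    · refine ⟨Equiv.swap 0 1, ?_⟩
      have h₂ : Equiv.swap (0 : Fin 3) 1 2 = 2 := by decide
      simpa [h₂, hd y x] using h

/-- An isotone mapping that preserves the smallest element preserves pseudoultrametrics. -/
theorem QPseudoUltra.comp_isotone {X Q L : Type*} {leQ : Q → Q → Prop} {leL : L → L → Prop}
    {q₀ : Q} {l₀ : L} {f : Q → L} {d : X → X → Q} (hd : QPseudoUltra leQ q₀ d)
    (hf : ∀ q₁ q₂, leQ q₁ q₂ → leL (f q₁) (f q₂)) (hf₀ : f q₀ = l₀) :
    QPseudoUltra leL l₀ (fun x y => f (d x y)) := by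
  refine ⟨fun x y => congrArg f (hd.1 x y), fun x => by simp [hd.2.1, hf₀], fun x y z => ?_⟩
  obtain ⟨σ, h₁, h₂⟩ := hd.2.2 x y z
  exact ⟨σ, hf _ _ h₁, congrArg f h₂⟩

/-- The isosceles triangle on `Fin 3` with legs `b` meeting at the vertex `1` and base `a`. -/
def isoscelesDist {Q : Type*} (q₀ a b : Q) (i j : Fin 3) : Q :=
  if i = j then q₀ else if i = 1 ∨ j = 1 then b else a

theorem qUltra_isoscelesDist {Q : Type*} {le : Q → Q → Prop} {q₀ a b : Q}
    (hq₀ : ∀ q, le q₀ q) (hab : le a b) (ha : a ≠ q₀) (hb : b ≠ q₀) :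
    QUltra le q₀ (isoscelesDist q₀ a b) := by
  have hsymm : ∀ i j, isoscelesDist q₀ a b i j = isoscelesDist q₀ a b j i := fun i j => by
    simp only [isoscelesDist, eq_comm, or_comm]
  refine ⟨⟨hsymm, fun i => by simp [isoscelesDist], fun i j k => ?_⟩, fun i j => ?_⟩
  · rw [permTriple_iff_of_symm hsymm]
    fin_cases i <;> fin_cases j <;> fin_cases k <;> simp [isoscelesDist, hq₀, hab]
  · unfold isoscelesDist
    split_ifs <;> simp_all

theorem QUltra.comp_injective {X Y Q : Type*} {le : Q → Q → Prop} {q₀ : Q} {d : X → X → Q}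
    (hd : QUltra le q₀ d) {g : Y → X} (hg : Function.Injective g) :
    QUltra le q₀ (fun x y => d (g x) (g y)) := by
  obtain ⟨⟨hsymm, hself, htri⟩, hzero⟩ := hd
  refine ⟨⟨fun x y => hsymm _ _, fun x => hself _, fun x y z => ?_⟩, fun x y => ?_⟩
  · rw [permTriple_iff_of_symm fun x y => hsymm (g x) (g y)]
    exact (permTriple_iff_of_symm hsymm _ _ _).1 (htri _ _ _)
  · rw [hzero, hg.eq_iff]

/-- Proposition 3.23: for posets `Q`, `L` with smallest elements `q₀`, `l₀` and
`f : Q → L`, the following are equivalent: (i) `f ∘ d` is an `L`-pseudoultrametric whenever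
`d` is a `Q`-pseudoultrametric; (ii) `f ∘ d` is an `L`-pseudoultrametric whenever `d` is a
`Q`-ultrametric; (iii) `f` is isotone and `f q₀ = l₀`. -/
theorem statement11 {Q : Type u} {L : Type v}
    (leQ : Q → Q → Prop) (leL : L → L → Prop) (q₀ : Q) (l₀ : L)
    (hQ : IsPartialOrder Q leQ) (hL : IsPartialOrder L leL)
    (hq₀ : ∀ q, leQ q₀ q) (hl₀ : ∀ l, leL l₀ l) (f : Q → L) :
    List.TFAE [
      ∀ (X : Type w) (_ : Nonempty X) (d : X → X → Q),
        QPseudoUltra leQ q₀ d → QPseudoUltra leL l₀ (fun x y => f (d x y)),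
      ∀ (X : Type w) (_ : Nonempty X) (d : X → X → Q),
        QUltra leQ q₀ d → QPseudoUltra leL l₀ (fun x y => f (d x y)),
      (∀ q₁ q₂, leQ q₁ q₂ → leL (f q₁) (f q₂)) ∧ f q₀ = l₀ ] := by
  tfae_have 1 → 2 := fun h X hX d hd => h X hX d hd.1
  tfae_have 3 → 1 := fun h X _ d hd => hd.comp_isotone h.1 h.2
  tfae_have 2 → 3 := by
    intro h
    have hf₀ : f q₀ = l₀ := by
      refine (h PUnit ⟨⟨⟩⟩ (fun _ _ => q₀) ⟨⟨fun _ _ => rfl, fun _ => rfl, fun _ _ _ =>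
        ⟨1, hq₀ _, rfl⟩⟩, fun _ _ => by simp⟩).2.1 ⟨⟩
    refine ⟨fun a b hab => ?_, hf₀⟩
    by_cases ha : a = q₀
    · rw [ha, hf₀]
      exact hl₀ _
    have hb : b ≠ q₀ := by
      rintro rfl
      exact ha (hQ.antisymm _ _ hab (hq₀ a))
    have hd := h (ULift.{w} (Fin 3)) ⟨⟨0⟩⟩ _
      ((qUltra_isoscelesDist hq₀ hab ha hb).comp_injective ULift.down_injective)
    have htri := (permTriple_iff_of_symm hd.1 _ _ _).1 (hd.2.2 ⟨0⟩ ⟨1⟩ ⟨2⟩)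
    simp only [isoscelesDist] at htri
    rcases htri with htri | htri | htri
    · simpa using htri
    · have hfab : f a = f b := by simpa using htri.2
      rw [hfab]
      exact hL.refl _
    · have hfab : f b = f a := by simpa using htri.2
      rw [hfab]
      exact hL.refl _
  tfae_finish

end CombSimPaper
end

section
/- Let (Q,≼_Q) and (L,≼_L) be posets with smallest elements q₀ ∈ Q and l₀ ∈ L. The following two conditions are equivalent for every mapping f : Q → L: (i) f ∘ d is an L-ultrametric whenever d is a Q-ultrametric (on any nonempty set X); (ii) f is isotone and, for every q ∈ Q, f(q) = l₀ holds if and only if q = q₀. -/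
namespace CombSimPaper

universe u v w

theorem permTriple_iff {X : Type*} {P : X → X → X → Prop} {x y z : X} :
    PermTriple P x y z ↔
      P x y z ∨ P x z y ∨ P y x z ∨ P y z x ∨ P z x y ∨ P z y x := by
  constructor
  · rintro ⟨σ, h⟩
    have h01 : σ 0 ≠ σ 1 := σ.injective.ne (by decide)
    have h02 : σ 0 ≠ σ 2 := σ.injective.ne (by decide)
    have h12 : σ 1 ≠ σ 2 := σ.injective.ne (by decide)
    generalize σ 0 = i, σ 1 = j, σ 2 = k at *
    fin_cases i <;> fin_cases j <;> fin_cases k <;> simp_all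
  · rintro (h | h | h | h | h | h)
    · exact ⟨1, h⟩
    · exact ⟨Equiv.swap 1 2, h⟩
    · exact ⟨Equiv.swap 0 1, h⟩
    · exact ⟨finRotate 3, h⟩
    · exact ⟨(finRotate 3)⁻¹, h⟩
    · exact ⟨Equiv.swap 0 2, h⟩

theorem QUltra.comp {X Q L : Type*} {leQ : Q → Q → Prop} {leL : L → L → Prop} {q₀ : Q} {l₀ : L}
    {f : Q → L} {d : X → X → Q} (hd : QUltra leQ q₀ d)
    (hf : ∀ q₁ q₂, leQ q₁ q₂ → leL (f q₁) (f q₂)) (hf₀ : ∀ q, f q = l₀ ↔ q = q₀) :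
    QUltra leL l₀ (fun x y => f (d x y)) := by
  obtain ⟨⟨hsymm, hself, htri⟩, hsep⟩ := hd
  refine ⟨⟨fun x y => congrArg f (hsymm x y), fun x => (hf₀ _).2 (hself x), ?_⟩,
    fun x y => (hf₀ _).trans (hsep x y)⟩
  intro x y z
  obtain ⟨σ, hle, heq⟩ := htri x y z
  exact ⟨σ, hf _ _ hle, congrArg f heq⟩

/-- The isosceles triangle with apex `1`, legs `b` and base `a`. -/
def triangleDist {Q : Type*} (q₀ a b : Q) (x y : ULift (Fin 3)) : Q :=
  if x.down = y.down then q₀ else if x.down = 1 ∨ y.down = 1 then b else a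

theorem qUltra_triangleDist {Q : Type*} {le : Q → Q → Prop} {q₀ a b : Q}
    (hrefl : ∀ q, le q q) (hq₀ : ∀ q, le q₀ q) (ha : a ≠ q₀) (hb : b ≠ q₀) (hab : le a b) :
    QUltra le q₀ (triangleDist q₀ a b) := by
  refine ⟨⟨?_, ?_, ?_⟩, ?_⟩
  · intro x y
    simp only [triangleDist, eq_comm, or_comm]
  · intro x
    simp [triangleDist]
  · rintro ⟨x⟩ ⟨y⟩ ⟨z⟩
    rw [permTriple_iff]
    fin_cases x <;> fin_cases y <;> fin_cases z <;> simp [triangleDist, hrefl, hq₀, hab]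
  · rintro ⟨x⟩ ⟨y⟩
    fin_cases x <;> fin_cases y <;> simp [triangleDist, ha, hb]

/-- Corollary 3.24: `f ∘ d` is an `L`-ultrametric whenever `d` is a `Q`-ultrametric iff
`f` is isotone and `f q = l₀ ↔ q = q₀` for every `q`. -/
theorem statement12 {Q : Type u} {L : Type v}
    (leQ : Q → Q → Prop) (leL : L → L → Prop) (q₀ : Q) (l₀ : L)
    (hQ : IsPartialOrder Q leQ) (hL : IsPartialOrder L leL)
    (hq₀ : ∀ q, leQ q₀ q) (hl₀ : ∀ l, leL l₀ l) (f : Q → L) :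
    (∀ (X : Type w) (_ : Nonempty X) (d : X → X → Q),
        QUltra leQ q₀ d → QUltra leL l₀ (fun x y => f (d x y))) ↔
      ((∀ q₁ q₂, leQ q₁ q₂ → leL (f q₁) (f q₂)) ∧ ∀ q, f q = l₀ ↔ q = q₀) := by
  constructor
  · intro h
    have hQrefl : ∀ q, leQ q q := hQ.refl
    have h₀ : f q₀ = l₀ :=
      (h PUnit ⟨⟨⟩⟩ (fun _ _ => q₀)
        ⟨⟨fun _ _ => rfl, fun _ => rfl, fun _ _ _ => ⟨1, hQrefl _, rfl⟩⟩,
          fun _ _ => ⟨fun _ => rfl, fun _ => rfl⟩⟩).1.2.1 ⟨⟩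
    have triangle {a b : Q} (ha : a ≠ q₀) (hb : b ≠ q₀) (hab : leQ a b) :
        QUltra leL l₀ (fun x y => f (triangleDist.{_, w} q₀ a b x y)) :=
      h _ ⟨⟨0⟩⟩ _ (qUltra_triangleDist hQrefl hq₀ ha hb hab)
    refine ⟨fun a b hab => ?_, fun q => ⟨fun hq => ?_, fun hq => hq ▸ h₀⟩⟩
    · by_cases ha : a = q₀
      · rw [ha, h₀]
        exact hl₀ _
      have hb : b ≠ q₀ := by
        rintro rfl
        exact ha (hQ.antisymm _ _ hab (hq₀ a))
      have hLrefl : ∀ l, leL l l := hL.refl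
      have htri := (triangle ha hb hab).1.2.2 ⟨0⟩ ⟨1⟩ ⟨2⟩
      rw [permTriple_iff] at htri
      simp only [triangleDist] at htri
      rcases htri with h | h | h | h | h | h <;> simp at h <;> grind
    · by_contra hne
      have hsep := ((triangle hne hne (hQrefl q)).2 ⟨0⟩ ⟨1⟩).1 (by simpa [triangleDist] using hq)
      simp at hsep
  · rintro ⟨hf, hf₀⟩ X _ d hd
    exact hd.comp hf hf₀

end CombSimPaper
end

section
/- Let X₁ and X₂ be nonempty sets and let Φᵢ be a mapping with domain Xᵢ², i = 1, 2. Suppose ≼₁ := u_{Φ₁}ᵗ ∪ Δ_{Φ₁(X₁²)} and ≼₂ := u_{Φ₂}ᵗ ∪ Δ_{Φ₂(X₂²)} are partial orders on Φ₁(X₁²) and Φ₂(X₂²) respectively, and that Φᵢ is a ≼ᵢ-pseudoultrametric for i = 1, 2. Then for every mapping g : X₁ → X₂, g is a weak similarity for Φ₁ and Φ₂ if and only if g is a combinatorial similarity for Φ₁ and Φ₂. -/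
namespace CombSimPaper

theorem uRel.map {X Y A B : Type*} {Φ : X → X → A} {Ψ : Y → Y → B} {g : Y → X} {f : A → B}
    (hg : Function.Surjective g) (hf : ∀ x y, Ψ x y = f (Φ (g x) (g y))) {a b : A}
    (h : uRel Φ a b) : uRel Ψ (f a) (f b) := by
  obtain ⟨x₁, x₂, x₃, rfl, rfl, h⟩ := h
  obtain ⟨y₁, rfl⟩ := hg x₁
  obtain ⟨y₂, rfl⟩ := hg x₂
  obtain ⟨y₃, rfl⟩ := hg x₃
  exact ⟨y₁, y₂, y₃, (hf _ _).symm, (hf _ _).symm, by rw [hf, hf, h]⟩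

theorem lePhi.map {X Y A B : Type*} {Φ : X → X → A} {Ψ : Y → Y → B} {g : Y → X} {f : A → B}
    (hg : Function.Surjective g) (hf : ∀ x y, Ψ x y = f (Φ (g x) (g y))) {a b : A}
    (h : lePhi Φ a b) : lePhi Ψ (f a) (f b) := by
  rcases h with h | ⟨rfl, x₁, x₂, rfl⟩
  · exact Or.inl (h.lift f fun _ _ => uRel.map hg hf)
  · obtain ⟨y₁, rfl⟩ := hg x₁
    obtain ⟨y₂, rfl⟩ := hg x₂
    exact Or.inr ⟨rfl, y₁, y₂, hf _ _⟩

theorem lePhi_iff_of_bijective {X Y A B : Type*} {Φ : X → X → A} {Ψ : Y → Y → B} {g : Y → X}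
    {f : A → B} (hg : Function.Bijective g) (hinj : Set.InjOn f (rng Φ))
    (hf : ∀ x y, Ψ x y = f (Φ (g x) (g y))) {a b : A} (ha : a ∈ rng Φ) (hb : b ∈ rng Φ) :
    lePhi Φ a b ↔ lePhi Ψ (f a) (f b) := by
  refine ⟨lePhi.map hg.surjective hf, fun h => ?_⟩
  have : Nonempty A := ⟨a⟩
  have hinv : Function.LeftInverse (Equiv.ofBijective g hg).symm g :=
    (Equiv.ofBijective g hg).symm_apply_apply
  have hf' : ∀ x y, Φ x y = Function.invFunOn f (rng Φ)
      (Ψ ((Equiv.ofBijective g hg).symm x) ((Equiv.ofBijective g hg).symm y)) := by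
    intro x y
    obtain ⟨x, rfl⟩ := hg.surjective x
    obtain ⟨y, rfl⟩ := hg.surjective y
    rw [hinv, hinv, hf]
    exact (hinj.leftInvOn_invFunOn ⟨g x, g y, rfl⟩).symm
  have h' := lePhi.map (Equiv.ofBijective g hg).symm.surjective hf' h
  rwa [hinj.leftInvOn_invFunOn ha, hinj.leftInvOn_invFunOn hb] at h'

/-- Theorem 4.3: if `≼ᵢ := u_{Φᵢ}ᵗ ∪ Δ_{Φᵢ(Xᵢ²)}` are partial orders on the ranges and each
`Φᵢ` is a `≼ᵢ`-pseudoultrametric, then a mapping `g : X₁ → X₂` is a weak similarity for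
`Φ₁` and `Φ₂` iff it is a combinatorial similarity for `Φ₁` and `Φ₂`. -/
theorem statement14 {X₁ X₂ A₁ A₂ : Type*} [Nonempty X₁] [Nonempty X₂]
    (Φ₁ : X₁ → X₁ → A₁) (Φ₂ : X₂ → X₂ → A₂)
    (h₁ : IsPartialOrderOn (rng Φ₁) (lePhi Φ₁))
    (h₂ : IsPartialOrderOn (rng Φ₂) (lePhi Φ₂))
    (b₁ : A₁) (b₂ : A₂)
    (hb₁ : ∀ a ∈ rng Φ₁, lePhi Φ₁ b₁ a) (hb₂ : ∀ a ∈ rng Φ₂, lePhi Φ₂ b₂ a)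
    (hΦ₁ : QPseudoUltra (lePhi Φ₁) b₁ Φ₁) (hΦ₂ : QPseudoUltra (lePhi Φ₂) b₂ Φ₂)
    (g : X₁ → X₂) :
    WeakSim (lePhi Φ₁) (lePhi Φ₂) Φ₁ Φ₂ g ↔ CombSimWith Φ₂ Φ₁ g := by
  constructor
  · rintro ⟨hg, f, hbij, -, hf⟩
    exact ⟨hg, f, hbij, hf⟩
  · rintro ⟨hg, f, hbij, hf⟩
    exact ⟨hg, f, hbij, fun a ha b hb => lePhi_iff_of_bijective hg hbij.injOn hf ha hb, hf⟩

end CombSimPaper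
end

section
/- Let X be a set with |X| = 2^ℵ₀. Then there is a metric d* : X² → ℝ⁺ such that: (i) if ρ is an arbitrary ultrametric, then ρ and d* are not combinatorially similar; and (ii) for every subset X₁ ⊆ X with |X₁| ≤ ℵ₀, the restriction of d* to X₁² is combinatorially similar to an ultrametric. -/
namespace CombSimPaper

universe u

/-- On a linearly ordered set, the distance between two distinct points is the weight of the
larger one. -/
noncomputable def maxDist {X : Type*} [LinearOrder X] (h : X → ℝ) (x y : X) : ℝ :=
  if x = y then 0 else h (max x y)

section maxDist

variable {X : Type*} [LinearOrder X] {h : X → ℝ}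

theorem maxDist_self (x : X) : maxDist h x x = 0 := if_pos rfl

theorem maxDist_of_ne {x y : X} (hxy : x ≠ y) : maxDist h x y = h (max x y) := if_neg hxy

theorem maxDist_comm (x y : X) : maxDist h x y = maxDist h y x := by
  simp only [maxDist, eq_comm, max_comm]

theorem maxDist_of_lt {x y : X} (hxy : x < y) : maxDist h x y = h y := by
  rw [maxDist_of_ne hxy.ne, max_eq_right hxy.le]

theorem maxDist_nonneg (hpos : ∀ x, 0 < h x) (x y : X) : 0 ≤ maxDist h x y := by
  unfold maxDist
  split_ifs
  exacts [le_rfl, (hpos _).le]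

theorem maxDist_eq_zero (hpos : ∀ x, 0 < h x) {x y : X} : maxDist h x y = 0 ↔ x = y := by
  unfold maxDist
  split_ifs with hxy
  · simp [hxy]
  · simp [hxy, (hpos _).ne']

theorem isMetric_maxDist (hh : ∀ x, h x ∈ Set.Icc (1 : ℝ) 2) : IsMetric (maxDist h) := by
  have hpos : ∀ x, 0 < h x := fun x => zero_lt_one.trans_le (hh x).1
  refine ⟨⟨maxDist_nonneg hpos, maxDist_comm, maxDist_self, fun x y z => ?_⟩,
    fun x y => maxDist_eq_zero hpos⟩
  by_cases hxz : x = z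
  · subst hxz; simp [maxDist_self]
  by_cases hzy : z = y
  · subst hzy; simp [maxDist_self]
  rw [maxDist_of_ne hxz, maxDist_of_ne hzy]
  have h₁ := (hh (max x z)).1
  have h₂ := (hh (max z y)).1
  unfold maxDist
  split_ifs
  · linarith
  · linarith [(hh (max x y)).2]

theorem isUltrametric_maxDist (hpos : ∀ x, 0 < h x) (hmono : Monotone h) :
    IsUltrametric (maxDist h) := by
  refine ⟨⟨maxDist_nonneg hpos, maxDist_comm, maxDist_self, fun x y z => ?_⟩,
    fun x y => maxDist_eq_zero hpos⟩
  by_cases hxz : x = z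
  · subst hxz; simp
  by_cases hzy : z = y
  · subst hzy; simp
  rw [maxDist_of_ne hxz, maxDist_of_ne hzy, ← hmono.map_max]
  unfold maxDist
  split_ifs
  · exact (hpos _).le
  · exact hmono (max_le (by simp) (by simp))

theorem maxDist_eq_maxDist_iff (hpos : ∀ x, 0 < h x) (hinj : h.Injective) {x y x' y' : X} :
    maxDist h x y = maxDist h x' y' ↔
      (x = y ∧ x' = y') ∨ (x ≠ y ∧ x' ≠ y' ∧ max x y = max x' y') := by
  unfold maxDist
  split_ifs with h₁ h₂ h₂
  · simp [h₁, h₂]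
  · simp [h₁, h₂, (hpos _).ne]
  · simp [h₁, h₂, (hpos _).ne']
  · simp [h₁, h₂, hinj.eq_iff]

end maxDist

theorem CombSim.of_eq_iff {X A B : Type*} [Nonempty B] {Φ : X → X → A} {Ψ : X → X → B}
    (hΦΨ : ∀ x y x' y', Φ x y = Φ x' y' ↔ Ψ x y = Ψ x' y') : CombSim Φ Ψ := by
  let f : A → B :=
    Function.extend (fun p : X × X => Φ p.1 p.2) (fun p => Ψ p.1 p.2) fun _ => Classical.arbitrary B
  have hf : ∀ x y, f (Φ x y) = Ψ x y := fun x y =>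
    Function.FactorsThrough.extend_apply (f := fun p : X × X => Φ p.1 p.2)
      (fun p q hpq => (hΦΨ p.1 p.2 q.1 q.2).1 hpq) _ (x, y)
  refine ⟨id, Function.bijective_id, f, ⟨?_, ?_, ?_⟩, fun x y => (hf x y).symm⟩
  · rintro _ ⟨x, y, rfl⟩
    exact ⟨x, y, (hf x y).symm⟩
  · rintro _ ⟨x, y, rfl⟩ _ ⟨x', y', rfl⟩ hxy
    rw [hf, hf] at hxy
    exact (hΦΨ x y x' y').2 hxy
  · rintro _ ⟨x, y, rfl⟩
    exact ⟨_, ⟨x, y, rfl⟩, hf x y⟩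

theorem exists_strictMono_of_combSim_maxDist {X Y : Type*} [LinearOrder X] [NoMinOrder X]
    {h : X → ℝ} (hinj : h.Injective) {ρ : Y → Y → ℝ} (hρ : IsUltrametric ρ)
    (hsim : CombSim (maxDist h) ρ) : ∃ φ : X → ℝ, StrictMono φ := by
  obtain ⟨g, hg, f, hf, hgf⟩ := hsim
  have hrng : ∀ x, h x ∈ rng (maxDist h) := fun x =>
    let ⟨z, hz⟩ := exists_lt x
    ⟨z, x, maxDist_of_lt hz⟩
  refine ⟨f ∘ h, fun x y hxy => lt_of_le_of_ne ?_ fun heq =>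
    hxy.ne (hinj (hf.injOn (hrng x) (hrng y) heq))⟩
  obtain ⟨z, hzx⟩ := exists_lt x
  obtain ⟨x, rfl⟩ := hg.2 x
  obtain ⟨y, rfl⟩ := hg.2 y
  obtain ⟨z, rfl⟩ := hg.2 z
  have htri := hρ.1.2.2.2 z x y
  rwa [hgf z x, hgf z y, hgf y x, maxDist_comm (g y), maxDist_of_lt hzx, maxDist_of_lt hxy,
    maxDist_of_lt (hzx.trans hxy), max_self] at htri

theorem not_strictMono_real_lex_bool (φ : ℝ ×ₗ Bool → ℝ) : ¬ StrictMono φ := by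
  intro hφ
  have hgap : ∀ x : ℝ, φ (toLex (x, false)) < φ (toLex (x, true)) := fun x =>
    hφ (Prod.Lex.toLex_lt_toLex.2 (Or.inr ⟨rfl, Bool.false_lt_true⟩))
  choose q hq₁ hq₂ using fun x => exists_rat_btwn (hgap x)
  have hq : StrictMono q := fun x y hxy => by
    have hlt : φ (toLex (x, true)) < φ (toLex (y, false)) :=
      hφ (Prod.Lex.toLex_lt_toLex.2 (Or.inl hxy))
    exact_mod_cast (hq₂ x).trans (hlt.trans (hq₁ y))
  exact not_countable hq.injective.countable

theorem combSim_maxDist_of_countable {X : Type*} [LinearOrder X] {h : X → ℝ}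
    (hpos : ∀ x, 0 < h x) (hinj : h.Injective) {S : Set X} (hS : S.Countable) :
    ∃ ρ : S → S → ℝ, IsUltrametric ρ ∧ CombSim (fun a b : S => maxDist h a.1 b.1) ρ := by
  have := hS.to_subtype
  obtain ⟨e⟩ := Order.embedding_from_countable_to_dense S ℝ
  have hmono : StrictMono fun a : S => Real.exp (e a) := Real.exp_strictMono.comp e.strictMono
  have hexp : ∀ a : S, 0 < Real.exp (e a) := fun a => Real.exp_pos _
  refine ⟨maxDist fun a => Real.exp (e a), isUltrametric_maxDist hexp hmono.monotone,
    CombSim.of_eq_iff fun x y x' y' => ?_⟩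
  rw [maxDist_eq_maxDist_iff hpos hinj, maxDist_eq_maxDist_iff hexp hmono.injective]
  simp only [ne_eq, Subtype.ext_iff, (Subtype.mono_coe (· ∈ S)).map_max]

/-- Proposition 4.8: on a set of cardinality `2^ℵ₀` there is a metric `d*` which is not
combinatorially similar to any ultrametric, although its restriction to every at most
countable subset is combinatorially similar to an ultrametric. -/
theorem statement16 {X : Type u} (hX : Cardinal.mk X = Cardinal.continuum) :
    ∃ dstar : X → X → ℝ, IsMetric dstar ∧
      (∀ (Y : Type u) (ρ : Y → Y → ℝ), IsUltrametric ρ → ¬ CombSim dstar ρ) ∧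
      (∀ X₁ : Set X, X₁.Countable →
        ∃ (Y : Type u) (ρ : Y → Y → ℝ), IsUltrametric ρ ∧
          CombSim (fun a b : X₁ => dstar a.1 b.1) ρ) := by
  have hlex : Cardinal.lift.{0} (Cardinal.mk X) = Cardinal.lift.{u} (Cardinal.mk (ℝ ×ₗ Bool)) := by
    have hL : Cardinal.mk (ℝ ×ₗ Bool) = Cardinal.continuum := by
      rw [Cardinal.mk_congr (ofLex : ℝ ×ₗ Bool ≃ ℝ × Bool)]
      simp [Cardinal.mk_real, Cardinal.continuum_mul_ofNat]
    rw [hX, hL]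
    simp
  have hIcc : Cardinal.lift.{0} (Cardinal.mk X) =
      Cardinal.lift.{u} (Cardinal.mk (Set.Icc (1 : ℝ) 2)) := by
    rw [hX, Cardinal.mk_Icc_real one_lt_two]
    simp
  obtain ⟨e⟩ := Cardinal.lift_mk_eq'.1 hlex
  obtain ⟨w⟩ := Cardinal.lift_mk_eq'.1 hIcc
  let : LinearOrder X := LinearOrder.lift' e e.injective
  have he : StrictMono e.symm := fun a b hab => by
    change e (e.symm a) < e (e.symm b)
    simpa using hab
  have : NoMinOrder X := ⟨fun a => ⟨e.symm (toLex ((ofLex (e a)).1 - 1, false)), by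
    rw [← e.symm_apply_apply a, he.lt_iff_lt, e.symm_apply_apply, Prod.Lex.lt_iff]
    exact Or.inl (sub_one_lt _)⟩⟩
  have hinj : Function.Injective fun x => (w x : ℝ) := Subtype.val_injective.comp w.injective
  refine ⟨maxDist fun x => (w x : ℝ), isMetric_maxDist fun x => (w x).2,
    fun Y ρ hρ hsim => ?_, fun S hS => ⟨S, combSim_maxDist_of_countable
      (fun x => zero_lt_one.trans_le (w x).2.1) hinj hS⟩⟩
  obtain ⟨φ, hφ⟩ := exists_strictMono_of_combSim_maxDist hinj hρ hsim
  exact not_strictMono_real_lex_bool _ (hφ.comp he)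

end CombSimPaper
end
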